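/- Let L and F₁ be finite extensions of a number field K inside a fixed algebraic closure. Then there exist infinitely many squarefree elements D of the ring of integers of K such that the field L' = L(√D) satisfies L·L' ∩ F₁ = L ∩ F₁. -/

import Mathlib

open IntermediateField NumberField

/-- Every element of `L(x)` with `x ^ 2 ∈ L` has the form `a + b * x` with `a, b ∈ L`. -/
theorem IntermediateField.exists_add_mul_of_mem_sup_adjoin_simple {K E : Type*} [Field K]
    [Field E] [Algebra K E] [Algebra.IsAlgebraic K E] {L : IntermediateField K E} {x z : E}
    (hx : x ^ 2 ∈ L) (hz : z ∈ L ⊔ K⟮x⟯) :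
    ∃ a ∈ L, ∃ b ∈ L, z = a + b * x := by
  let S : Subalgebra K E :=
    { carrier := {z | ∃ a ∈ L, ∃ b ∈ L, z = a + b * x}
      mul_mem' := by
        rintro _ _ ⟨a, ha, b, hb, rfl⟩ ⟨c, hc, d, hd, rfl⟩
        exact ⟨a * c + b * d * x ^ 2,
          add_mem (mul_mem ha hc) (mul_mem (mul_mem hb hd) hx), a * d + b * c,
          add_mem (mul_mem ha hd) (mul_mem hb hc), by ring⟩
      add_mem' := by
        rintro _ _ ⟨a, ha, b, hb, rfl⟩ ⟨c, hc, d, hd, rfl⟩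
        exact ⟨a + c, add_mem ha hc, b + d, add_mem hb hd, by ring⟩
      algebraMap_mem' := fun r ↦ ⟨_, L.algebraMap_mem r, 0, zero_mem L, by simp⟩ }
  have hle : (L ⊔ K⟮x⟯).toSubalgebra ≤ S := by
    rw [sup_toSubalgebra_of_isAlgebraic_left,
      adjoin_simple_toSubalgebra_of_isAlgebraic (Algebra.IsAlgebraic.isAlgebraic x)]
    refine sup_le (fun a ha ↦ ⟨a, ha, 0, zero_mem L, by simp⟩) (Algebra.adjoin_le ?_)
    rintro _ rfl
    exact ⟨0, zero_mem L, 1, one_mem L, by simp⟩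
  exact hle hz

/-- If `x ^ 2 ∈ L` and `x ∉ L ⊔ F`, then adjoining `x` to `L` does not enlarge `L ⊓ F`. -/
theorem IntermediateField.sup_adjoin_simple_inf_eq {K E : Type*} [Field K] [Field E]
    [Algebra K E] [Algebra.IsAlgebraic K E] {L F : IntermediateField K E} {x : E}
    (hx : x ^ 2 ∈ L) (hxLF : x ∉ L ⊔ F) : (L ⊔ K⟮x⟯) ⊓ F = L ⊓ F := by
  refine le_antisymm ?_ (inf_le_inf_right _ le_sup_left)
  rintro z ⟨hz, hzF⟩
  obtain ⟨a, ha, b, hb, rfl⟩ := exists_add_mul_of_mem_sup_adjoin_simple hx hz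
  obtain rfl | hb0 := eq_or_ne b 0
  · exact ⟨by simpa using ha, hzF⟩
  · refine absurd ?_ hxLF
    have hL : L ≤ L ⊔ F := le_sup_left
    have hF : F ≤ L ⊔ F := le_sup_right
    have hxeq : x = (a + b * x - a) / b := by field_simp; ring
    rw [hxeq]
    exact div_mem (sub_mem (hF hzF) (hL ha)) (hL hb)

/-- A rational prime not dividing the norm of the different is squarefree in `𝓞 M`. -/
theorem NumberField.squarefree_natCast_of_not_dvd_absNorm_differentIdeal {M : Type*} [Field M]
    [NumberField M] {p : ℕ} (hp : p.Prime)
    (hpd : ¬ p ∣ Ideal.absNorm (differentIdeal ℤ (𝓞 M))) : Squarefree (p : 𝓞 M) := by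
  intro y hy
  by_contra hyu
  have hpZ : Prime (p : ℤ) := Nat.prime_iff_prime_int.mp hp
  have : (Ideal.span {(p : ℤ)}).IsMaximal :=
    PrincipalIdealRing.isMaximal_of_irreducible hpZ.irreducible
  have hdvd : Ideal.span {y} ^ (2 - 1) ∣ differentIdeal ℤ (𝓞 M) := by
    refine pow_sub_one_dvd_differentIdeal ℤ (p := Ideal.span {(p : ℤ)}) _ 2
      (by simpa using hp.ne_zero) ?_
    rw [Ideal.map_span, Set.image_singleton, Ideal.span_singleton_pow, Ideal.dvd_iff_le,
      Ideal.span_singleton_le_span_singleton, sq]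
    simpa using hy
  rw [pow_one] at hdvd
  have hN : Ideal.absNorm (Ideal.span {y}) ∣ p ^ Module.finrank ℤ (𝓞 M) := by
    have hle : Ideal.span {(p : 𝓞 M)} ≤ Ideal.span {y} :=
      Ideal.span_singleton_le_span_singleton.mpr ((Dvd.intro _ rfl).trans hy)
    have h := Ideal.absNorm_dvd_absNorm_of_le hle
    rwa [Ideal.absNorm_span_natCast] at h
  obtain ⟨k, -, hk⟩ := (Nat.dvd_prime_pow hp).mp hN
  refine hpd (dvd_trans ?_ (map_dvd Ideal.absNorm hdvd))
  rw [hk]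
  refine dvd_pow_self p ?_
  rintro rfl
  rw [pow_zero, Ideal.absNorm_eq_one_iff, Ideal.span_singleton_eq_top] at hk
  exact hyu hk

/-- Squarefreeness of a rational integer descends to the ring of integers of a subfield. -/
theorem NumberField.squarefree_natCast_of_algebra {K M : Type*} [Field K] [NumberField K]
    [Field M] [NumberField M] [Algebra K M] {n : ℕ} (h : Squarefree (n : 𝓞 M)) :
    Squarefree (n : 𝓞 K) := fun y hy ↦
  (h _ (by simpa using map_dvd (algebraMap (𝓞 K) (𝓞 M)) hy)).of_map

/-- A rational prime that is squarefree in `𝓞 M` is not a square in `M`. -/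
theorem NumberField.sq_ne_natCast_of_squarefree {M : Type*} [Field M] [NumberField M] {p : ℕ}
    (hp : p.Prime) (h : Squarefree (p : 𝓞 M)) (y : M) : y ^ 2 ≠ p := by
  intro hy
  have hint : IsIntegral ℤ y := by
    refine IsIntegral.of_pow (n := 2) two_pos ?_
    rw [hy]
    exact map_natCast (algebraMap ℤ M) p ▸ isIntegral_algebraMap
  obtain ⟨w, rfl⟩ : ∃ w : 𝓞 M, (w : M) = y := ⟨⟨y, hint⟩, rfl⟩
  have hw : w ^ 2 = p := RingOfIntegers.ext (by simpa using hy)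
  have hu : IsUnit (p : 𝓞 M) := hw ▸ (h w (by rw [← sq, hw])).pow 2
  have hN : Ideal.absNorm (Ideal.span {(p : 𝓞 M)}) = 1 := by
    rw [Ideal.absNorm_eq_one_iff, Ideal.span_singleton_eq_top]
    exact hu
  rw [Ideal.absNorm_span_natCast] at hN
  exact hp.one_lt.ne' ((Nat.pow_eq_one.mp hN).resolve_right Module.finrank_pos.ne')

/-- Lemma (inffield): for finite extensions `L, F₁` of a number field `K` in a
fixed algebraic closure, there are infinitely many squarefree `D ∈ 𝓞 K` such
that `L' = L(√D)` satisfies `LL' ∩ F₁ = L ∩ F₁` (note `LL' = L(√D) = L ⊔ K(√D)`). -/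
theorem stmt_11 {K : Type*} [Field K] [NumberField K]
    (L F₁ : IntermediateField K (AlgebraicClosure K))
    [FiniteDimensional K ↥L] [FiniteDimensional K ↥F₁] :
    {D : 𝓞 K | Squarefree D ∧
      ∀ x : AlgebraicClosure K,
        x ^ 2 = algebraMap K (AlgebraicClosure K) (algebraMap (𝓞 K) K D) →
          (L ⊔ K⟮x⟯) ⊓ F₁ = L ⊓ F₁}.Infinite := by
  have : NumberField ↥(L ⊔ F₁) := NumberField.of_module_finite K _
  set N := Ideal.absNorm (differentIdeal ℤ (𝓞 ↥(L ⊔ F₁)))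
  have hN0 : N ≠ 0 := Ideal.absNorm_eq_zero_iff.not.mpr differentIdeal_ne_bot
  have hinf : {p : ℕ | p.Prime ∧ N < p}.Infinite :=
    Set.infinite_of_forall_exists_gt fun n ↦ by
      obtain ⟨p, hle, hp⟩ := Nat.exists_infinite_primes (max n N + 1)
      exact ⟨p, ⟨hp, by omega⟩, by omega⟩
  refine (hinf.image (f := ((↑) : ℕ → 𝓞 K)) Nat.cast_injective.injOn).mono ?_
  rintro _ ⟨p, ⟨hp, hlt⟩, rfl⟩
  have hsq : Squarefree (p : 𝓞 ↥(L ⊔ F₁)) :=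
    squarefree_natCast_of_not_dvd_absNorm_differentIdeal hp
      (Nat.not_dvd_of_pos_of_lt (Nat.pos_of_ne_zero hN0) hlt)
  refine ⟨squarefree_natCast_of_algebra hsq, fun x hx ↦ ?_⟩
  refine sup_adjoin_simple_inf_eq (hx ▸ L.algebraMap_mem _) fun hxM ↦ ?_
  refine sq_ne_natCast_of_squarefree hp hsq ⟨x, hxM⟩ (Subtype.ext ?_)
  simpa using hx
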